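/- Let n ≥ 2 be an integer and set α = 2ⁿ + 1, m = (α+1)²(α−1), and r = α² − 1. Then there does not exist a nontrivial regular partial difference set with parameters (m², r(m+1), −m + r² + 3r, r² + r) in any abelian group G of order m². -/

import Mathlib

/-- `D` is a `(v,k,λ,μ)` partial difference set in the group `G` (written
multiplicatively): `|G| = v`, `|D| = k`, every non-identity element of `D` is represented
exactly `lam` times as `g * h⁻¹` with `g, h ∈ D`, `g ≠ h`, and every non-identity element
of `G` not in `D` exactly `mu` times. -/
def IsPDS {G : Type*} [Group G] (D : Set G) (v k lam mu : ℕ) : Prop :=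
  Nat.card G = v ∧ D.ncard = k ∧
  (∀ z : G, z ≠ 1 → z ∈ D →
    {p : G × G | p.1 ∈ D ∧ p.2 ∈ D ∧ p.1 ≠ p.2 ∧ p.1 * p.2⁻¹ = z}.ncard = lam) ∧
  (∀ z : G, z ≠ 1 → z ∉ D →
    {p : G × G | p.1 ∈ D ∧ p.2 ∈ D ∧ p.1 ≠ p.2 ∧ p.1 * p.2⁻¹ = z}.ncard = mu)

/-- `D` is regular: it avoids the identity and is closed under inversion. -/
def IsRegularPDS {G : Type*} [Group G] (D : Set G) : Prop :=
  (1 : G) ∉ D ∧ ∀ g ∈ D, g⁻¹ ∈ D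

/-- `D` is a trivial PDS: `D ∪ {1}` or `G \ D` is a subgroup of `G`. -/
def IsTrivialPDS {G : Type*} [Group G] (D : Set G) : Prop :=
  (∃ H : Subgroup G, D ∪ {1} = (H : Set G)) ∨ ∃ H : Subgroup G, Dᶜ = (H : Set G)


/-- The group algebra of an abelian group of order prime to `p` over `ZMod p` has no nonzero
square-zero elements. -/
theorem groupAlgebra_sq_zero {Q : Type*} [CommGroup Q] [Fintype Q] (p : ℕ) [Fact p.Prime]
    (hp : Nat.Coprime (Nat.card Q) p) (x : MonoidAlgebra (ZMod p) Q) (hx : x * x = 0) : x = 0 := by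
  classical
  have : CharP (MonoidAlgebra (ZMod p) Q) p := by
    refine charP_of_injective_ringHom
      (f := (MonoidAlgebra.singleOneRingHom : ZMod p →+* MonoidAlgebra (ZMod p) Q)) ?_ p
    intro a b h
    exact MonoidAlgebra.single_right_injective h
  have hxp : x ^ p = 0 := by
    have h2 : 2 ≤ p := (Fact.out : p.Prime).two_le
    obtain ⟨t, rfl⟩ := Nat.exists_eq_add_of_le h2
    rw [pow_add, pow_two, hx, zero_mul]
  have hsum : x = ∑ q : Q, MonoidAlgebra.single q (x.coeff q) := by
    conv_lhs => rw [← MonoidAlgebra.sum_coeff_single x]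
    exact Finsupp.sum_fintype _ _ (fun i => by simp)
  have hpow : x ^ p = ∑ q : Q, MonoidAlgebra.single (q ^ p) (x.coeff q ^ p) := by
    conv_lhs => rw [hsum, sum_pow_char p]
    simp only [MonoidAlgebra.single_pow]
  have hinj : ∀ a b : Q, a ^ p = b ^ p → a = b := fun a b h => (powCoprime hp).injective h
  ext g
  have h3 : (x ^ p).coeff (g ^ p) = 0 := by rw [hxp]; simp
  rw [hpow, MonoidAlgebra.coeff_sum, Finsupp.finsetSum_apply,
    Finset.sum_eq_single g] at h3
  · rw [MonoidAlgebra.coeff_single, Finsupp.single_eq_same] at h3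
    simpa using eq_zero_of_pow_eq_zero h3
  · intro b _ hb
    rw [MonoidAlgebra.coeff_single, Finsupp.single_eq_of_ne]
    intro h; exact hb (hinj _ _ h.symm)
  · simp

theorem groupAlgebra_dvd {Q : Type*} [CommGroup Q] [Fintype Q] (d : ℕ) :
    Nat.Coprime (Nat.card Q) d → ∀ (c : ℤ) (x : MonoidAlgebra ℤ Q), (d : ℤ) ∣ c →
      x * x = c • x → ∃ y : MonoidAlgebra ℤ Q, x = (d : ℤ) • y := by
  induction d using Nat.strong_induction_on with
  | _ d ih =>
    intro hd c x hc hx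
    rcases eq_or_ne d 1 with rfl | h1
    · exact ⟨x, by simp⟩
    rcases eq_or_ne d 0 with rfl | h0
    · have : c = 0 := by simpa using hc
      subst this
      have hcard : Nat.card Q = 1 := by simpa using hd
      have : Subsingleton Q := (Nat.card_eq_one_iff_unique.1 hcard).1
      refine ⟨0, ?_⟩
      have h2 : (x * x).coeff 1 = 0 := by rw [hx]; simp
      have h3 : x = MonoidAlgebra.single 1 (x.coeff 1) := by
        ext g; rw [Subsingleton.elim g 1]; simp
      rw [h3, MonoidAlgebra.single_mul_single] at h2
      simp at h2
      rw [h3, h2]; simp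
    obtain ⟨p, hp, e, rfl⟩ := Nat.exists_prime_and_dvd h1
    have : Fact p.Prime := ⟨hp⟩
    have hcp : Nat.Coprime (Nat.card Q) p := Nat.Coprime.coprime_mul_right_right hd
    have hce : Nat.Coprime (Nat.card Q) e := Nat.Coprime.coprime_mul_left_right hd
    obtain ⟨c', rfl⟩ := hc
    have hmap := groupAlgebra_sq_zero p hcp
      (MonoidAlgebra.mapRingHom Q (Int.castRingHom (ZMod p)) x) (by
        rw [← map_mul, hx]
        ext g
        rw [MonoidAlgebra.coeff_mapRingHom, MonoidAlgebra.coeff_smul_apply]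
        simp)
    have hdv : ∀ g, (p : ℤ) ∣ x.coeff g := by
      intro g
      have := congrArg (fun z => z.coeff g) hmap
      simpa [ZMod.intCast_zmod_eq_zero_iff_dvd] using this
    choose f hf using hdv
    let y : MonoidAlgebra ℤ Q := .ofCoeff (Finsupp.equivFunOnFinite.symm f)
    have hy : x = (p : ℤ) • y := by
      ext g; rw [MonoidAlgebra.coeff_smul_apply, hf]; rfl
    have hp0 : (p : ℤ) ≠ 0 := by exact_mod_cast hp.ne_zero
    have hyy : y * y = ((e : ℤ) * c') • y := by
      rw [hy] at hx
      ext g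
      have := congrArg (fun z => z.coeff g) hx
      simp only [smul_mul_assoc, mul_smul_comm, MonoidAlgebra.coeff_smul_apply, smul_eq_mul] at this ⊢
      apply mul_left_cancel₀ hp0
      apply mul_left_cancel₀ hp0
      rw [this]; push_cast; ring
    have he0 : e ≠ 0 := by rintro rfl; simp at h0
    obtain ⟨w, hw⟩ := ih e (by nlinarith [hp.two_le, Nat.pos_of_ne_zero he0]) hce _ y
      (Dvd.intro _ rfl) hyy
    exact ⟨w, by rw [hy, hw, smul_smul]; push_cast; rfl⟩

theorem pds_square {G R : Type*} [CommGroup G] [Fintype G] [DecidableEq G] [CommRing R]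
    (χ : G →* R) (D : Finset G) (k lam mu : ℕ) (h1 : (1 : G) ∉ D) (hinv : ∀ g ∈ D, g⁻¹ ∈ D)
    (hk : D.card = k)
    (hl : ∀ z : G, z ≠ 1 → z ∈ D → ((D ×ˢ D).filter fun p => p.1 * p.2⁻¹ = z).card = lam)
    (hm : ∀ z : G, z ≠ 1 → z ∉ D → ((D ×ˢ D).filter fun p => p.1 * p.2⁻¹ = z).card = mu) :
    (∑ g ∈ D, χ g) * (∑ g ∈ D, χ g) =
      ((k : R) - mu) + ((lam : R) - mu) * (∑ g ∈ D, χ g) + mu * ∑ g : G, χ g := by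
  have hX : ∑ g ∈ D, χ g = ∑ g ∈ D, χ g⁻¹ :=
    Finset.sum_nbij' (fun g => g⁻¹) (fun g => g⁻¹) (by simpa using hinv) (by simpa using hinv)
      (by simp) (by simp) (by simp)
  have e1 : (∑ g ∈ D, χ g) * (∑ g ∈ D, χ g) = ∑ p ∈ D ×ˢ D, χ (p.1 * p.2⁻¹) := by
    conv_lhs => rw [hX]
    rw [← hX]
    conv_lhs => arg 2; rw [hX]
    rw [Finset.sum_mul_sum, Finset.sum_product]
    simp
  have e2 : ∑ p ∈ D ×ˢ D, χ (p.1 * p.2⁻¹) =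
      ∑ z : G, (((D ×ˢ D).filter fun p => p.1 * p.2⁻¹ = z).card : R) * χ z := by
    rw [← Finset.sum_fiberwise (D ×ˢ D) (fun p => p.1 * p.2⁻¹)]
    refine Finset.sum_congr rfl fun z _ => ?_
    rw [Finset.sum_congr rfl (g := fun _ => χ z), Finset.sum_const, nsmul_eq_mul]
    intro p hp
    rw [(Finset.mem_filter.1 hp).2]
  have e3 : ∀ z : G, (((D ×ˢ D).filter fun p => p.1 * p.2⁻¹ = z).card : R) =
      (if z = 1 then ((k : R) - mu) else 0) + (if z ∈ D then ((lam : R) - mu) else 0) + mu := by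
    intro z
    by_cases hz : z = 1
    · subst hz
      have : ((D ×ˢ D).filter fun p => p.1 * p.2⁻¹ = 1).card = k := by
        rw [← hk]
        symm
        refine Finset.card_nbij' (fun g => (g, g)) (fun p => p.1) ?_ ?_ ?_ ?_
        · intro g hg; simpa using hg
        · intro p hp; simp at hp; exact hp.1.1
        · intro g hg; rfl
        · intro p hp
          simp [mul_inv_eq_one] at hp
          exact Prod.ext rfl hp.2
      rw [this]; simp [h1]
    · by_cases hd : z ∈ D
      · rw [hl z hz hd]; simp [hz, hd]
      · rw [hm z hz hd]; simp [hz, hd]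
  rw [e1, e2]
  simp only [e3, add_mul, Finset.sum_add_distrib, ite_mul, zero_mul, Finset.sum_ite_eq',
    Finset.mem_univ, if_true, map_one, mul_one, Finset.mul_sum]
  congr 2
  rw [← Finset.sum_filter]
  congr 1
  ext; simp

theorem core {G Q : Type*} [CommGroup G] [Fintype G] [DecidableEq G] [CommGroup Q] [Fintype Q]
    (D : Finset G) (π : G →* Q) (hπ : Function.Surjective π) (u s : ℕ) (hs : Odd s) (hs3 : 3 ≤ s) (hu : u + 4 = 4 * s)
    (hinv : ∀ g ∈ D, g⁻¹ ∈ D)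
    (hH : Nat.card π.ker = s ^ 4) (hQ : Nat.card (Q) = 4 * u ^ 2)
    (hcop : Nat.Coprime (4 * u ^ 2) (s ^ 2))
    (hk : D.card = u * s * (2 * u * s ^ 2 + 1))
    (hsq : ∀ χ : G →* MonoidAlgebra ℤ (Q), (∑ g ∈ D, χ g) * (∑ g ∈ D, χ g) =
      ((2 * u ^ 2 * s ^ 3 - u ^ 2 * s ^ 2 : ℤ) : MonoidAlgebra ℤ (Q))
        + ((2 * u * s - 2 * u * s ^ 2 : ℤ) : MonoidAlgebra ℤ (Q)) * (∑ g ∈ D, χ g)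
        + ((u ^ 2 * s ^ 2 + u * s : ℤ) : MonoidAlgebra ℤ (Q)) * ∑ g : G, χ g) :
    False := by
  classical
  let ofQ : Q →* MonoidAlgebra ℤ Q := MonoidAlgebra.of ℤ Q
  have h0 := hsq (ofQ.comp π)
  set X : MonoidAlgebra ℤ Q := ∑ g ∈ D, (ofQ.comp π) g with hX
  set S : MonoidAlgebra ℤ Q := ∑ q : Q, ofQ q with hS
  have hoS : ∀ q, ofQ q * S = S := by
    intro q
    rw [hS, Finset.mul_sum]
    simp only [← map_mul]
    exact Fintype.sum_equiv (Equiv.mulLeft q) _ _ (fun _ => rfl)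
  have hXS : X * S = (D.card : MonoidAlgebra ℤ Q) * S := by
    rw [hX, Finset.sum_mul]
    simp [hoS]
  have hSS : S * S = (4 * u ^ 2 : MonoidAlgebra ℤ Q) * S := by
    conv_lhs => arg 1; rw [hS]
    rw [Finset.sum_mul]
    simp only [hoS]
    rw [Finset.sum_const, nsmul_eq_mul, Finset.card_univ, ← Nat.card_eq_fintype_card, hQ]
    push_cast; ring
  have hT : ∑ g : G, (ofQ.comp π) g = (s ^ 4 : MonoidAlgebra ℤ Q) * S := by
    rw [← Finset.sum_fiberwise Finset.univ π, hS, Finset.mul_sum]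
    refine Finset.sum_congr rfl fun q _ => ?_
    rw [Finset.sum_congr rfl (g := fun _ => ofQ q), Finset.sum_const, nsmul_eq_mul]
    · congr 1
      have h1 : (Finset.univ.filter fun g => π g = q).card = 
          (Finset.univ.filter fun g => π g = 1).card :=
        MonoidHom.card_fiber_eq_of_mem_range π (hπ q) (hπ 1)
      have h2 : (Finset.univ.filter fun g => π g = 1).card = s ^ 4 := by
        rw [← hH, Nat.card_eq_fintype_card, Fintype.card_subtype]
        congr 1
        ext g
        simp [MonoidHom.mem_ker]
      rw [h1, h2]; push_cast; rfl
    · intro g hg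
      rw [MonoidHom.comp_apply, (Finset.mem_filter.1 hg).2]
  rw [hT] at h0
  rw [hk] at hXS
  push_cast at h0 hXS
  set E : MonoidAlgebra ℤ Q := 2 * X - 2 * u * s - s ^ 3 * S with hE
  have hEE : E * E = (-4 * u * s ^ 2 : ℤ) • E := by
    rw [zsmul_eq_mul, hE]
    push_cast
    linear_combination 4 * h0 - 4 * s ^ 3 * hXS + s ^ 6 * hSS
  obtain ⟨y, hy⟩ := groupAlgebra_dvd (s ^ 2) (hQ ▸ hcop) _ E
    ⟨-4 * u, by push_cast; ring⟩ hEE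
  have hs0 : ((s ^ 2 : ℕ) : ℤ) ≠ 0 := by positivity
  have hyy : y * y = (-4 * u : ℤ) • y := by
    rw [hy] at hEE
    ext g
    have := congrArg (fun z => z.coeff g) hEE
    simp only [smul_mul_assoc, mul_smul_comm, MonoidAlgebra.coeff_smul_apply, smul_eq_mul] at this ⊢
    apply mul_left_cancel₀ hs0
    apply mul_left_cancel₀ hs0
    rw [this]; push_cast; ring
  -- coefficients
  have hXc : ∀ q, X.coeff q = ((D.filter fun g => π g = q).card : ℤ) := by
    intro q
    rw [hX, MonoidAlgebra.coeff_sum, Finsupp.finsetSum_apply, Finset.card_filter]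
    push_cast
    refine Finset.sum_congr rfl fun g _ => ?_
    simp [ofQ, Finsupp.single_apply]
  have hSc : ∀ q, S.coeff q = 1 := by
    intro q
    rw [hS, MonoidAlgebra.coeff_sum, Finsupp.finsetSum_apply]
    rw [Finset.sum_eq_single q]
    · simp [ofQ]
    · intro b _ hb
      simp [ofQ, hb]
    · simp
  have hEc : ∀ q, E.coeff q = 2 * X.coeff q - (if q = 1 then (2 * u * s : ℤ) else 0) - s ^ 3 := by
    intro q
    have : E = (2 : ℤ) • X - MonoidAlgebra.single 1 ((2 * u * s : ℤ)) - (s ^ 3 : ℤ) • S := by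
      rw [hE, zsmul_eq_mul, zsmul_eq_mul]
      have : (MonoidAlgebra.single 1 ((2 * u * s : ℤ)) : MonoidAlgebra ℤ Q) =
        ((2 * u * s : ℤ) : MonoidAlgebra ℤ Q) := rfl
      rw [this]; push_cast; rfl
    rw [this]
    simp only [MonoidAlgebra.coeff_sub, Finsupp.sub_apply, MonoidAlgebra.coeff_smul_apply,
      MonoidAlgebra.coeff_single, Finsupp.single_apply, hSc, smul_eq_mul, mul_one, eq_comm]
  have hyc : ∀ q, E.coeff q = (s : ℤ) ^ 2 * y.coeff q := by
    intro q
    rw [hy, MonoidAlgebra.coeff_smul_apply]; push_cast; rfl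
  have hXsym : ∀ q, X.coeff q⁻¹ = X.coeff q := by
    intro q
    rw [hXc, hXc]
    congr 1
    refine Finset.card_nbij' (fun g => g⁻¹) (fun g => g⁻¹) ?_ ?_ (fun g _ => inv_inv g)
      (fun g _ => inv_inv g)
    · intro g hg
      simp only [Finset.coe_filter, Set.mem_ofPred_eq] at hg ⊢
      exact ⟨hinv g hg.1, by rw [map_inv, hg.2, inv_inv]⟩
    · intro g hg
      simp only [Finset.coe_filter, Set.mem_ofPred_eq] at hg ⊢
      exact ⟨hinv g hg.1, by rw [map_inv, hg.2]⟩
  have hs2 : (s : ℤ) ^ 2 ≠ 0 := by positivity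
  have hysym : ∀ q, y.coeff q⁻¹ = y.coeff q := by
    intro q
    apply mul_left_cancel₀ hs2
    rw [← hyc, ← hyc, hEc, hEc, hXsym]
    simp
  have hyodd : ∀ q, Odd (y.coeff q) := by
    intro q
    have h1 : Odd (E.coeff q) := by
      rw [hEc]
      have h3 : Odd ((s : ℤ) ^ 3) := ((Int.odd_coe_nat s).2 hs).pow
      refine Even.sub_odd ?_ h3
      refine Even.sub (even_two_mul _) ?_
      split_ifs
      · exact ⟨u * s, by ring⟩
      · simp
    rw [hyc] at h1
    exact (Int.odd_mul.1 h1).2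
  have hone : ∑ q : Q, y.coeff q * y.coeff q = -4 * u * y.coeff 1 := by
    have h1 : (y * y).coeff 1 = -4 * u * y.coeff 1 := by
      rw [hyy, MonoidAlgebra.coeff_smul_apply]; rfl
    rw [← h1, MonoidAlgebra.coeff_mul_apply_left, Finsupp.sum_fintype _ _ (by simp)]
    simp [hysym]
  have hge : (4 * u ^ 2 : ℤ) ≤ ∑ q : Q, y.coeff q * y.coeff q := by
    have : ∑ q : Q, (1 : ℤ) ≤ ∑ q : Q, y.coeff q * y.coeff q := by
      refine Finset.sum_le_sum fun q _ => ?_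
      have : y.coeff q ≠ 0 := by
        intro h; have := hyodd q; rw [h] at this; simp at this
      have := mul_self_pos.2 this
      lia
    simp only [Finset.sum_const, Finset.card_univ, ← Nat.card_eq_fintype_card, hQ] at this
    simpa using this
  have hX1 : 0 ≤ X.coeff 1 := by rw [hXc]; positivity
  have hE1 := hEc 1
  rw [hyc, if_pos rfl] at hE1
  have hu0 : (0 : ℤ) < u := by lia
  have hle : (u : ℤ) ≤ - y.coeff 1 := by nlinarith
  obtain ⟨w, hw⟩ := hyodd 1
  have hlt : (u : ℤ) + 1 ≤ - y.coeff 1 := by lia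
  have hu' : (u : ℤ) = 4 * s - 4 := by lia
  have hs3' : (3 : ℤ) ≤ s := by exact_mod_cast hs3
  have h5 : (s : ℤ) * (s * (u + 1)) ≤ s * (2 * u + s ^ 2) := by nlinarith
  have h6 := le_of_mul_le_mul_left h5 (by lia)
  rw [hu'] at h6
  nlinarith

theorem no_nontrivial_pds_in_family
    (n : ℕ) (hn : 2 ≤ n) (α m r : ℕ)
    (hα : α = 2 ^ n + 1) (hm : m = (α + 1) ^ 2 * (α - 1)) (hr : r = α ^ 2 - 1)
    (G : Type*) [CommGroup G] (D : Set G)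
    (hpds : IsPDS D (m ^ 2) (r * (m + 1)) (r ^ 2 + 3 * r - m) (r ^ 2 + r))
    (hreg : IsRegularPDS D) :
    IsTrivialPDS D := by
  exfalso
  classical
  obtain ⟨t, rfl⟩ : ∃ t, n = t + 2 := ⟨n - 2, by lia⟩
  set s : ℕ := 2 ^ (t + 1) + 1 with hs
  set u : ℕ := 2 ^ (t + 3) with hu
  have hus : u + 4 = 4 * s := by rw [hu, hs]; ring
  have hs3 : 3 ≤ s := by
    have : 1 ≤ 2 ^ t := Nat.one_le_two_pow
    rw [hs, pow_succ]; lia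
  have hodd : Odd s := ⟨2 ^ t, by rw [hs]; ring⟩
  have hα' : α = 2 * s - 1 := by rw [hα, hs, pow_succ 2 (t + 1)]; lia
  have hm' : m = 2 * u * s ^ 2 := by
    have h1 : α + 1 = 2 * s := by lia
    have h2 : 2 * (α - 1) = u := by lia
    rw [hm, h1, ← h2]; ring
  have hr' : r = u * s := by
    have h1 : α + 1 = 2 * s := by lia
    have h2 : 2 * (α - 1) = u := by lia
    have h3 : α ^ 2 - 1 = (α + 1) * (α - 1) := by
      simpa using Nat.sq_sub_sq α 1
    rw [hr, h3, h1, ← h2]; ring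
  obtain ⟨hv, hk, hl, hmu⟩ := hpds
  obtain ⟨hr1, hr2⟩ := hreg
  have hu0 : 0 < u := by positivity
  have hm0 : 0 < m := by rw [hm']; positivity
  have : Finite G := Nat.finite_of_card_ne_zero (by rw [hv]; positivity)
  let _ : Fintype G := Fintype.ofFinite G
  have hcard : Nat.card G = 4 * u ^ 2 * s ^ 4 := by rw [hv, hm']; ring
  have h4u : 4 * u ^ 2 = 2 ^ (2 * t + 8) := by rw [hu]; ring
  have : Fact (Nat.Prime 2) := ⟨Nat.prime_two⟩
  obtain ⟨K, hK⟩ := Sylow.exists_subgroup_card_pow_prime (G := G) 2 (n := 2 * t + 8)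
    (by rw [hcard, h4u]; exact Dvd.intro _ rfl)
  rw [← h4u] at hK
  have hKi : K.index = s ^ 4 := by
    have := K.card_mul_index
    rw [hK, hcard] at this
    exact Nat.eq_of_mul_eq_mul_left (by positivity) this
  have hcop : ∀ j, Nat.Coprime (4 * u ^ 2) (s ^ j) := by
    intro j
    rw [h4u]
    exact Nat.Coprime.pow _ _ (Nat.coprime_two_left.2 hodd)
  obtain ⟨H, hH⟩ := Subgroup.exists_right_complement'_of_coprime (N := K)
    (by rw [hK, hKi]; exact hcop 4)
  have hHc : Nat.card H = s ^ 4 := by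
    have := hH.card_mul_card
    rw [hK, hcard] at this
    exact Nat.eq_of_mul_eq_mul_left (by positivity) this
  have hQ : Nat.card (G ⧸ H) = 4 * u ^ 2 := by
    have := H.card_mul_index
    rw [hHc, hcard, mul_comm] at this
    exact Nat.eq_of_mul_eq_mul_right (by positivity) this
  have hDk : D.toFinset.card = r * (m + 1) := by rw [← hk, Set.ncard_eq_toFinset_card']
  have hset : ∀ z : G, z ≠ 1 →
      ((D.toFinset ×ˢ D.toFinset).filter fun p => p.1 * p.2⁻¹ = z).card =
      {p : G × G | p.1 ∈ D ∧ p.2 ∈ D ∧ p.1 ≠ p.2 ∧ p.1 * p.2⁻¹ = z}.ncard := by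
    intro z hz
    rw [← Set.ncard_coe_finset]
    congr 1
    ext p
    simp only [Finset.coe_filter, Finset.mem_product, Set.mem_toFinset, Set.mem_ofPred_eq]
    constructor
    · rintro ⟨⟨h1, h2⟩, h3⟩
      exact ⟨h1, h2, fun h => hz (by rw [← h3, h, mul_inv_cancel]), h3⟩
    · rintro ⟨h1, h2, _, h3⟩
      exact ⟨⟨h1, h2⟩, h3⟩
  have hinv : ∀ g ∈ D.toFinset, g⁻¹ ∈ D.toFinset := by simpa using hr2
  let _ : Fintype (G ⧸ H) := Fintype.ofFinite _
  refine core D.toFinset (QuotientGroup.mk' H) (QuotientGroup.mk'_surjective H) u s hodd hs3 hus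
    hinv (by rw [QuotientGroup.ker_mk']; exact hHc) hQ (hcop 2)
    (by rw [hDk, hm', hr']) ?_
  intro χ
  have hmain := pds_square χ D.toFinset _ _ _ (by simpa using hr1) hinv hDk
    (fun z hz hd => by rw [hset z hz]; exact hl z hz (by simpa using hd))
    (fun z hz hd => by rw [hset z hz]; exact hmu z hz (by simpa using hd))
  rw [hmain]
  have hge : m ≤ r ^ 2 + 3 * r := by
    rw [hm', hr']
    have : 2 ≤ u := by lia
    have h1 : 2 * (u * s ^ 2) ≤ u * (u * s ^ 2) := Nat.mul_le_mul_right _ this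
    nlinarith
  rw [Nat.cast_sub hge, hm', hr']
  push_cast
  ring
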